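/- Let d ≥ 1, let G ⊂ ℤ^d be a finite set of size N, let I = I_1 × ⋯ × I_d ⊂ ℝ^d be a product of bounded intervals, let c₀ > 0, and let (ξ_l)_{l∈G} ⊂ ℝ^d satisfy |ξ_{l,i} − ξ_{l',i}| ≥ c₀ |l_i − l'_i| / |I_i| for all i and all l, l' ∈ G. Then for any 2 < r < q, any totally ordered index set T, and any family (c_t)_{t∈T} of vectors c_t = (c_{t,l})_{l∈G} ∈ ℓ²(G), one has ‖ ‖∑_{l∈G} c_{t,l} e(ξ_l · y)‖_{V^q_t} ‖_{L²_y(I)} ≤ C (q/(q−r) + 2/(r−2)) |I|^{1/2} N^{(1/2 − 1/r) q/(q−2)} ‖c_t‖_{V^r_t(ℓ²(G))}, where C = C(c₀, d) and ‖c_t‖_{V^r_t(ℓ²(G))} is the homogeneous r-variation of the ℓ²(G)-valued family (c_t). -/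

import Mathlib

open MeasureTheory ENNReal
open scoped NNReal

/-- The homogeneous `q`-variation (semi)norm of a family `u : ι → E`, valued in `ℝ≥0∞`. -/
noncomputable def hVar {ι : Type*} [LinearOrder ι] {E : Type*} [NormedAddCommGroup E]
    (q : ℝ) (u : ι → E) : ℝ≥0∞ :=
  ⨆ (J : ℕ) (t : Fin (J + 1) → ι) (_ : StrictMono t),
    (∑ j : Fin J, (‖u (t j.succ) - u (t j.castSucc)‖₊ : ℝ≥0∞) ^ q) ^ (1 / q)

/-- The inhomogeneous `q`-variation norm `(‖u‖_{V^q}^q + (sup_t ‖u t‖)^q)^(1/q)`. -/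
noncomputable def iVar {ι : Type*} [LinearOrder ι] {E : Type*} [NormedAddCommGroup E]
    (q : ℝ) (u : ι → E) : ℝ≥0∞ :=
  (hVar q u ^ q + (⨆ t, (‖u t‖₊ : ℝ≥0∞)) ^ q) ^ (1 / q)

/-- `e(x) = exp(2πix)`. -/
noncomputable def ce (x : ℝ) : ℂ := Complex.exp (Complex.I * (2 * Real.pi * x))

theorem sum_prod_le_tsum_pow {d : ℕ} (G : Finset (Fin d → ℤ)) (ρ : ℤ → ℝ) (hρ0 : ∀ n, 0 ≤ ρ n)
    (hρ : Summable ρ) (l : Fin d → ℤ) :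
    ∑ l' ∈ G, ∏ i, ρ (l i - l' i) ≤ (∑' n, ρ n) ^ d := by
  classical
  have hsub : G ⊆ Fintype.piFinset (fun i => G.image (fun l' => l' i)) := by
    intro l' hl'
    simp only [Fintype.mem_piFinset, Finset.mem_image]
    exact fun i => ⟨l', hl', rfl⟩
  calc ∑ l' ∈ G, ∏ i, ρ (l i - l' i)
      ≤ ∑ l' ∈ Fintype.piFinset (fun i => G.image (fun l' => l' i)), ∏ i, ρ (l i - l' i) :=
        Finset.sum_le_sum_of_subset_of_nonneg hsub
          (fun _ _ _ => Finset.prod_nonneg fun i _ => hρ0 _)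
    _ = ∏ i, ∑ n ∈ G.image (fun l' => l' i), ρ (l i - n) :=
        (Finset.prod_univ_sum _ (fun i n => ρ (l i - n))).symm
    _ ≤ ∏ _i : Fin d, ∑' n, ρ n := by
        refine Finset.prod_le_prod (fun i _ => Finset.sum_nonneg fun n _ => hρ0 _) fun i _ => ?_
        have hs : Summable fun n => ρ (l i - n) := (Equiv.subLeft (l i)).summable_iff.2 hρ
        calc ∑ n ∈ G.image (fun l' => l' i), ρ (l i - n) ≤ ∑' n, ρ (l i - n) :=
              hs.sum_le_tsum _ fun n _ => hρ0 _
          _ = ∑' n, ρ n := (Equiv.subLeft (l i)).tsum_eq ρ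
    _ = (∑' n, ρ n) ^ d := by simp

theorem schur_test {ι : Type*} [Fintype ι] (k : ι → ι → ℝ) (A : ℝ) (hk0 : ∀ l l', 0 ≤ k l l')
    (hsymm : ∀ l l', k l l' = k l' l) (hA : ∀ l, ∑ l', k l l' ≤ A) (x : ι → ℝ) :
    ∑ l, ∑ l', x l * x l' * k l l' ≤ A * ∑ l, x l ^ 2 := by
  have h1 : ∑ l, ∑ l', x l ^ 2 * k l l' ≤ A * ∑ l, x l ^ 2 := by
    rw [Finset.mul_sum]
    refine Finset.sum_le_sum fun l _ => ?_
    rw [← Finset.mul_sum, mul_comm]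
    exact mul_le_mul_of_nonneg_right (hA l) (sq_nonneg _)
  have h2 : ∑ l, ∑ l', x l' ^ 2 * k l l' = ∑ l, ∑ l', x l ^ 2 * k l l' := by
    rw [Finset.sum_comm]
    simp_rw [fun l l' => hsymm l' l]
  have h3 : ∑ l, ∑ l', x l * x l' * k l l'
      ≤ ∑ l, ∑ l', (x l ^ 2 * k l l' + x l' ^ 2 * k l l') / 2 := by
    refine Finset.sum_le_sum fun l _ => Finset.sum_le_sum fun l' _ => ?_
    nlinarith [mul_nonneg (sq_nonneg (x l - x l')) (hk0 l l')]
  simp_rw [← Finset.sum_div, Finset.sum_add_distrib] at h3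
  linarith

theorem summable_exp_neg_mul_int_sq {α : ℝ} (hα : 0 < α) :
    Summable fun n : ℤ => Real.exp (-α * (n : ℝ) ^ 2) := by
  have h : Summable fun n : ℕ => Real.exp (-α * (n : ℝ) ^ 2) :=
    Real.summable_exp_nat_mul_of_ge (neg_neg_of_pos hα) fun i => by
      exact_mod_cast Nat.le_self_pow two_ne_zero i
  exact Summable.of_nat_of_neg (by simpa using h) (by simpa using h)

theorem norm_gaussian_integral {d : ℕ} (β a η : Fin d → ℝ) (hβ : ∀ i, 0 < β i) :
    ‖∫ y : Fin d → ℝ, Complex.exp (-∑ i, (β i : ℂ) * (y i : ℂ) ^ 2 +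
        ∑ i, ((2 * a i * β i : ℝ) + (2 * Real.pi * η i : ℝ) * Complex.I) * y i)‖
      = ∏ i, Real.sqrt (Real.pi / β i) *
          Real.exp (a i ^ 2 * β i - Real.pi ^ 2 * η i ^ 2 / β i) := by
  rw [GaussianFourier.integral_cexp_neg_sum_mul_add (by simpa using hβ), norm_prod]
  refine Finset.prod_congr rfl fun i _ => ?_
  rw [norm_mul, Complex.norm_exp]
  have hb := (hβ i).ne'
  congr 1
  · rw [← Complex.ofReal_div, show (1 / 2 : ℂ) = ((1 / 2 : ℝ) : ℂ) by norm_num,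
      ← Complex.ofReal_cpow (div_nonneg Real.pi_pos.le (hβ i).le), Complex.norm_real,
      Real.sqrt_eq_rpow, Real.norm_of_nonneg (by have := hβ i; positivity)]
  · congr 1
    have : (((2 * a i * β i : ℝ) : ℂ) + (2 * Real.pi * η i : ℝ) * Complex.I) ^ 2 / (4 * (β i : ℂ))
        = ((a i ^ 2 * β i - Real.pi ^ 2 * η i ^ 2 / β i : ℝ) : ℂ)
          + ((2 * a i * Real.pi * η i : ℝ) : ℂ) * Complex.I := by
      have : (β i : ℂ) ≠ 0 := by exact_mod_cast hb
      push_cast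
      field_simp
      linear_combination (4 * (Real.pi : ℂ) ^ 2 * (η i : ℂ) ^ 2) * Complex.I_sq
    rw [this, Complex.add_re, Complex.ofReal_re, Complex.re_ofReal_mul]
    simp

/-- The exponential sum `∑ l, v l * e(ξ l ⬝ y)` over a finite set of frequencies. -/
noncomputable def expSum {d : ℕ} {G : Finset (Fin d → ℤ)} (ξ : (Fin d → ℤ) → (Fin d → ℝ))
    (v : EuclideanSpace ℂ {l // l ∈ G}) (y : Fin d → ℝ) : ℂ :=
  ∑ l : {l // l ∈ G}, v l * ce (∑ i, ξ (l : Fin d → ℤ) i * y i)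

theorem norm_ce (x : ℝ) : ‖ce x‖ = 1 := by
  rw [ce, mul_comm, show (2 * (Real.pi : ℂ) * x) = ((2 * Real.pi * x : ℝ) : ℂ) by push_cast; ring,
    Complex.norm_exp_ofReal_mul_I]

theorem conj_ce (x : ℝ) : (starRingEnd ℂ) (ce x) = ce (-x) := by
  rw [ce, ce, ← Complex.exp_conj]
  simp [Complex.conj_ofNat]

theorem continuous_expSum {d : ℕ} {G : Finset (Fin d → ℤ)} (ξ : (Fin d → ℤ) → (Fin d → ℝ))
    (v : EuclideanSpace ℂ {l // l ∈ G}) : Continuous (expSum ξ v) := by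
  unfold expSum ce
  fun_prop

theorem gaussian_mul_norm_expSum_sq {d : ℕ} {G : Finset (Fin d → ℤ)}
    (ξ : (Fin d → ℤ) → (Fin d → ℝ)) (v : EuclideanSpace ℂ {l // l ∈ G}) (β a y : Fin d → ℝ) :
    ((Real.exp (-∑ i, β i * y i ^ 2 + ∑ i, 2 * a i * β i * y i) * ‖expSum ξ v y‖ ^ 2 : ℝ) : ℂ)
      = ∑ l, ∑ l', v l * (starRingEnd ℂ) (v l') *
        Complex.exp (-∑ i, (β i : ℂ) * (y i : ℂ) ^ 2 + ∑ i, ((2 * a i * β i : ℝ) +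
          (2 * Real.pi * (ξ l i - ξ l' i) : ℝ) * Complex.I) * y i) := by
  rw [Complex.ofReal_mul, Complex.ofReal_pow, ← Complex.mul_conj', expSum, map_sum,
    Finset.sum_mul_sum, Finset.mul_sum]
  refine Finset.sum_congr rfl fun l _ => ?_
  rw [Finset.mul_sum]
  refine Finset.sum_congr rfl fun l' _ => ?_
  rw [map_mul, conj_ce, ce, ce, Complex.ofReal_exp]
  have : ∀ A B C D E F : ℂ, A + B + C = F →
      Complex.exp A * (D * Complex.exp B * (E * Complex.exp C)) = D * E * Complex.exp F := by
    rintro A B C D E F rfl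
    rw [Complex.exp_add, Complex.exp_add]
    ring
  apply this
  push_cast
  rw [← Finset.sum_neg_distrib, ← Finset.sum_neg_distrib, Finset.mul_sum, Finset.mul_sum,
    Finset.mul_sum, Finset.mul_sum, ← Finset.sum_add_distrib, ← Finset.sum_add_distrib,
    ← Finset.sum_add_distrib, ← Finset.sum_add_distrib]
  refine Finset.sum_congr rfl fun i _ => ?_
  ring

theorem exists_lintegral_expSum_sq_le (d : ℕ) (c₀ : ℝ) (hc₀ : 0 < c₀) :
    ∃ K : ℝ≥0, 1 ≤ K ∧ ∀ (G : Finset (Fin d → ℤ)) (a b : Fin d → ℝ), (∀ i, a i < b i) →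
      ∀ ξ : (Fin d → ℤ) → (Fin d → ℝ),
      (∀ l ∈ G, ∀ l' ∈ G, ∀ i,
        c₀ * |(l i : ℝ) - (l' i : ℝ)| / (b i - a i) ≤ |ξ l i - ξ l' i|) →
      ∀ v : EuclideanSpace ℂ {l // l ∈ G},
      ∫⁻ y in Set.univ.pi (fun i => Set.Icc (a i) (b i)), ‖expSum ξ v y‖ₑ ^ (2 : ℝ)
        ≤ K * (∏ i, ENNReal.ofReal (b i - a i)) * ‖v‖ₑ ^ (2 : ℝ) := by
  have hα : 0 < Real.pi ^ 2 * c₀ ^ 2 := by positivity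
  set ρ : ℤ → ℝ := fun n => Real.exp (-(Real.pi ^ 2 * c₀ ^ 2) * (n : ℝ) ^ 2) with hρdef
  have hρ0 : ∀ n, 0 ≤ ρ n := fun n => (Real.exp_pos _).le
  have hρ : Summable ρ := summable_exp_neg_mul_int_sq hα
  set K₀ : ℝ := (Real.exp 1 * Real.sqrt Real.pi) ^ d * (∑' n, ρ n) ^ d with hK₀
  refine ⟨max 1 K₀.toNNReal, le_max_left _ _, fun G a b hab ξ hξ v => ?_⟩
  set L : Fin d → ℝ := fun i => b i - a i with hL
  have hL0 : ∀ i, 0 < L i := fun i => sub_pos.2 (hab i)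
  set β : Fin d → ℝ := fun i => (L i ^ 2)⁻¹ with hβdef
  have hβ : ∀ i, 0 < β i := fun i => by have := hL0 i; positivity
  set κ : ℝ := Real.exp (∑ i, (1 - a i ^ 2 * β i)) with hκ
  set W : (Fin d → ℝ) → ℝ := fun y => Real.exp (-∑ i, β i * y i ^ 2 + ∑ i, 2 * a i * β i * y i)
    with hW
  set g : {l // l ∈ G} → {l // l ∈ G} → (Fin d → ℝ) → ℂ := fun l l' y =>
    Complex.exp (-∑ i, (β i : ℂ) * (y i : ℂ) ^ 2 + ∑ i, ((2 * a i * β i : ℝ) +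
          (2 * Real.pi * (ξ l i - ξ l' i) : ℝ) * Complex.I) * y i) with hg
  have hgint : ∀ l l', Integrable (g l l') := fun l l' =>
    GaussianFourier.integrable_cexp_neg_sum_mul_add (by simpa using hβ) _
  have hid : ∀ y, ((W y * ‖expSum ξ v y‖ ^ 2 : ℝ) : ℂ)
      = ∑ l, ∑ l', v l * (starRingEnd ℂ) (v l') * g l l' y := fun y =>
    gaussian_mul_norm_expSum_sq ξ v β a y
  have hWint : Integrable fun y => ((W y * ‖expSum ξ v y‖ ^ 2 : ℝ) : ℂ) := by
    simp_rw [hid]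
    exact integrable_finsetSum _ fun l _ => integrable_finsetSum _ fun l' _ =>
      (hgint l l').const_mul _
  have hintR : Integrable fun y => W y * ‖expSum ξ v y‖ ^ 2 := by
    simpa only [RCLike.re_to_complex, Complex.ofReal_re] using hWint.re
  have hker : ∀ l l' : {l // l ∈ G}, κ * ‖∫ y, g l l' y‖ ≤
      ((∏ i, L i) * (Real.exp 1 * Real.sqrt Real.pi) ^ d) * ∏ i, ρ (l.1 i - l'.1 i) := by
    intro l l'
    rw [hg, norm_gaussian_integral β a (fun i => ξ l i - ξ l' i) hβ, hκ, Real.exp_sum,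
      ← Finset.prod_mul_distrib]
    have : (Real.exp 1 * Real.sqrt Real.pi) ^ d
      = ∏ _i : Fin d, (Real.exp 1 * Real.sqrt Real.pi) := by simp
    rw [this, ← Finset.prod_mul_distrib, ← Finset.prod_mul_distrib]
    refine Finset.prod_le_prod (fun i _ => by positivity) fun i _ => ?_
    have hLi := hL0 i
    have h1 : Real.sqrt (Real.pi / β i) = Real.sqrt Real.pi * L i := by
      rw [hβdef]
      simp only [div_inv_eq_mul]
      rw [Real.sqrt_mul Real.pi_pos.le, Real.sqrt_sq hLi.le]
    have h2 : Real.exp (1 - a i ^ 2 * β i) *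
        Real.exp (a i ^ 2 * β i - Real.pi ^ 2 * (ξ l i - ξ l' i) ^ 2 / β i)
        ≤ Real.exp 1 * ρ (l.1 i - l'.1 i) := by
      rw [hρdef, ← Real.exp_add]
      simp only
      rw [← Real.exp_add, Real.exp_le_exp]
      have h3 := hξ l l.2 l' l'.2 i
      rw [div_le_iff₀ hLi] at h3
      have h4 : (c₀ * |((l.1 i : ℝ)) - (l'.1 i : ℝ)|) ^ 2 ≤ (|ξ l i - ξ l' i| * L i) ^ 2 :=
        pow_le_pow_left₀ (by positivity) h3 2
      rw [mul_pow, mul_pow, sq_abs, sq_abs] at h4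
      have h5 : Real.pi ^ 2 * (ξ l i - ξ l' i) ^ 2 / β i
          = Real.pi ^ 2 * ((ξ l i - ξ l' i) ^ 2 * L i ^ 2) := by
        rw [hβdef]; field_simp
      rw [h5]
      push_cast
      nlinarith [mul_le_mul_of_nonneg_left h4 (sq_nonneg Real.pi)]
    rw [h1]
    calc _ = Real.sqrt Real.pi * L i * (Real.exp (1 - a i ^ 2 * β i) *
        Real.exp (a i ^ 2 * β i - Real.pi ^ 2 * (ξ l i - ξ l' i) ^ 2 / β i)) := by ring
      _ ≤ Real.sqrt Real.pi * L i * (Real.exp 1 * ρ (l.1 i - l'.1 i)) := by gcongr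
      _ = _ := by ring
  have hschur : κ * ∫ y, W y * ‖expSum ξ v y‖ ^ 2 ≤ K₀ * (∏ i, L i) * ‖v‖ ^ 2 := by
    have e1 : ((∫ y, W y * ‖expSum ξ v y‖ ^ 2 : ℝ) : ℂ)
        = ∑ l, ∑ l', v l * (starRingEnd ℂ) (v l') * ∫ y, g l l' y := by
      rw [← integral_complex_ofReal]
      simp_rw [hid]
      rw [integral_finsetSum _ fun l _ => integrable_finsetSum _ fun l' _ =>
        (hgint l l').const_mul _]
      refine Finset.sum_congr rfl fun l _ => ?_
      rw [integral_finsetSum _ fun l' _ => (hgint l l').const_mul _]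
      refine Finset.sum_congr rfl fun l' _ => integral_const_mul _ _
    have e2 : ∫ y, W y * ‖expSum ξ v y‖ ^ 2
        ≤ ∑ l, ∑ l', ‖v l‖ * ‖v l'‖ * ‖∫ y, g l l' y‖ := by
      calc ∫ y, W y * ‖expSum ξ v y‖ ^ 2
          ≤ ‖((∫ y, W y * ‖expSum ξ v y‖ ^ 2 : ℝ) : ℂ)‖ := by
            rw [Complex.norm_real]; exact Real.le_norm_self _
        _ ≤ _ := by
          rw [e1]
          refine (norm_sum_le _ _).trans (Finset.sum_le_sum fun l _ =>
            (norm_sum_le _ _).trans (Finset.sum_le_sum fun l' _ => ?_))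
          rw [norm_mul, norm_mul, RCLike.norm_conj]
    have hκ0 : 0 < κ := Real.exp_pos _
    have hP0 : 0 ≤ (∏ i, L i) * (Real.exp 1 * Real.sqrt Real.pi) ^ d :=
      mul_nonneg (Finset.prod_nonneg fun i _ => (hL0 i).le) (by positivity)
    calc κ * ∫ y, W y * ‖expSum ξ v y‖ ^ 2
        ≤ κ * ∑ l, ∑ l', ‖v l‖ * ‖v l'‖ * ‖∫ y, g l l' y‖ := by gcongr
      _ = ∑ l, ∑ l', ‖v l‖ * ‖v l'‖ * (κ * ‖∫ y, g l l' y‖) := by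
          simp_rw [Finset.mul_sum]
          refine Finset.sum_congr rfl fun l _ => Finset.sum_congr rfl fun l' _ => by ring
      _ ≤ ∑ l, ∑ l', ‖v l‖ * ‖v l'‖ * (((∏ i, L i) * (Real.exp 1 * Real.sqrt Real.pi) ^ d) *
            ∏ i, ρ (l.1 i - l'.1 i)) := by
          exact Finset.sum_le_sum fun l _ => Finset.sum_le_sum fun l' _ =>
            mul_le_mul_of_nonneg_left (hker l l') (by positivity)
      _ ≤ (((∏ i, L i) * (Real.exp 1 * Real.sqrt Real.pi) ^ d) * (∑' n, ρ n) ^ d) *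
            ∑ l, ‖v l‖ ^ 2 := by
          refine schur_test _ _ (fun l l' => mul_nonneg hP0 (Finset.prod_nonneg fun i _ => hρ0 _))
            (fun l l' => ?_) (fun l => ?_) _
          · congr 1
            refine Finset.prod_congr rfl fun i _ => ?_
            rw [hρdef]
            simp only
            congr 2
            push_cast
            ring
          · rw [← Finset.mul_sum]
            refine mul_le_mul_of_nonneg_left ?_ hP0
            have := sum_prod_le_tsum_pow G ρ hρ0 hρ l.1
            rwa [← Finset.sum_coe_sort] at this
      _ = K₀ * (∏ i, L i) * ‖v‖ ^ 2 := by
          rw [EuclideanSpace.norm_sq_eq, hK₀]; ring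
  have hpt : ∀ y ∈ Set.univ.pi (fun i => Set.Icc (a i) (b i)), 1 ≤ κ * W y := by
    intro y hy
    rw [hκ, hW, ← Real.exp_add, Real.one_le_exp_iff, ← Finset.sum_neg_distrib,
      ← Finset.sum_add_distrib, ← Finset.sum_add_distrib]
    refine Finset.sum_nonneg fun i _ => ?_
    have hyi := hy i (Set.mem_univ i)
    have h1 : (y i - a i) ^ 2 ≤ L i ^ 2 :=
      pow_le_pow_left₀ (sub_nonneg.2 hyi.1) (by simp only [hL]; linarith [hyi.2]) 2
    have h2 : (y i - a i) ^ 2 * β i ≤ 1 := by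
      rw [hβdef]
      simp only
      rw [← div_eq_mul_inv]
      exact (div_le_one (by have := hL0 i; positivity)).2 h1
    nlinarith
  calc ∫⁻ y in Set.univ.pi (fun i => Set.Icc (a i) (b i)), ‖expSum ξ v y‖ₑ ^ (2 : ℝ)
      ≤ ∫⁻ y in Set.univ.pi (fun i => Set.Icc (a i) (b i)),
          ENNReal.ofReal (κ * (W y * ‖expSum ξ v y‖ ^ 2)) := by
        refine setLIntegral_mono' (MeasurableSet.univ_pi fun i => measurableSet_Icc) fun y hy => ?_
        rw [← ofReal_norm, ENNReal.ofReal_rpow_of_nonneg (norm_nonneg _) (by norm_num)]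
        refine ENNReal.ofReal_le_ofReal ?_
        rw [Real.rpow_two, ← mul_assoc]
        exact le_mul_of_one_le_left (sq_nonneg _) (hpt y hy)
    _ ≤ ∫⁻ y, ENNReal.ofReal (κ * (W y * ‖expSum ξ v y‖ ^ 2)) := setLIntegral_le_lintegral _ _
    _ = ENNReal.ofReal (κ * ∫ y, W y * ‖expSum ξ v y‖ ^ 2) := by
        rw [← integral_const_mul, ofReal_integral_eq_lintegral_ofReal (hintR.const_mul κ)]
        exact Filter.Eventually.of_forall fun y => by positivity
    _ ≤ ENNReal.ofReal (K₀ * (∏ i, L i) * ‖v‖ ^ 2) := ENNReal.ofReal_le_ofReal hschur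
    _ = ENNReal.ofReal K₀ * (∏ i, ENNReal.ofReal (b i - a i)) * ‖v‖ₑ ^ (2 : ℝ) := by
        have hK0 : 0 ≤ K₀ := mul_nonneg (by positivity) (pow_nonneg (tsum_nonneg hρ0) d)
        rw [ENNReal.ofReal_mul (mul_nonneg hK0 (Finset.prod_nonneg fun i _ => (hL0 i).le)),
          ENNReal.ofReal_mul hK0, ENNReal.ofReal_prod_of_nonneg fun i _ => (hL0 i).le,
          ← ofReal_norm v, ENNReal.ofReal_rpow_of_nonneg (norm_nonneg _) (by norm_num),
          Real.rpow_two]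
    _ ≤ _ := by
        gcongr
        rw [ENNReal.ofReal]
        exact_mod_cast le_max_right _ _

section Variation

variable {T : Type*} [LinearOrder T] {E : Type*} [NormedAddCommGroup E]

theorem hVar_def' (q : ℝ) (u : T → E) : hVar q u =
    ⨆ (J : ℕ) (t : Fin (J + 1) → T) (_ : StrictMono t),
      (∑ j : Fin J, ‖u (t j.succ) - u (t j.castSucc)‖ₑ ^ q) ^ (1 / q) := rfl

theorem le_hVar (q : ℝ) (u : T → E) {J : ℕ} {t : Fin (J + 1) → T} (ht : StrictMono t) :
    (∑ j : Fin J, ‖u (t j.succ) - u (t j.castSucc)‖ₑ ^ q) ^ (1 / q) ≤ hVar q u := by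
  rw [hVar_def']
  exact le_iSup_of_le J (le_iSup_of_le t (le_iSup_of_le ht le_rfl))

theorem hVar_le {q : ℝ} {u : T → E} {B : ℝ≥0∞}
    (h : ∀ (J : ℕ) (t : Fin (J + 1) → T), StrictMono t →
      (∑ j : Fin J, ‖u (t j.succ) - u (t j.castSucc)‖ₑ ^ q) ^ (1 / q) ≤ B) : hVar q u ≤ B := by
  rw [hVar_def']
  exact iSup_le fun J => iSup_le fun t => iSup_le fun ht => h J t ht

theorem sum_le_hVar_rpow {q : ℝ} (hq : 0 < q) (u : T → E) {J : ℕ} {t : Fin (J + 1) → T}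
    (ht : StrictMono t) :
    ∑ j : Fin J, ‖u (t j.succ) - u (t j.castSucc)‖ₑ ^ q ≤ hVar q u ^ q := by
  have := ENNReal.rpow_le_rpow (le_hVar q u ht) hq.le
  rwa [← ENNReal.rpow_mul, one_div_mul_cancel hq.ne', ENNReal.rpow_one] at this

theorem hVar_add_le {q : ℝ} (hq : 1 ≤ q) (u v : T → E) :
    hVar q (fun t => u t + v t) ≤ hVar q u + hVar q v := by
  refine hVar_le fun J t ht => ?_
  calc (∑ j : Fin J, ‖(u (t j.succ) + v (t j.succ)) - (u (t j.castSucc) + v (t j.castSucc))‖ₑ ^ q)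
        ^ (1 / q)
      ≤ (∑ j : Fin J, (‖u (t j.succ) - u (t j.castSucc)‖ₑ
          + ‖v (t j.succ) - v (t j.castSucc)‖ₑ) ^ q) ^ (1 / q) := by
        gcongr with j
        rw [add_sub_add_comm]
        exact enorm_add_le _ _
    _ ≤ _ := ENNReal.Lp_add_le _ _ _ hq
    _ ≤ _ := add_le_add (le_hVar q u ht) (le_hVar q v ht)

theorem hVar_eq_zero_of_const {q : ℝ} (hq : 0 < q) {u : T → E} (h : ∀ s t, u s = u t) :
    hVar q u = 0 := by
  refine le_antisymm (hVar_le fun J t _ => ?_) zero_le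
  simp [fun s => h s (t 0), hq]

theorem hVar_le_of_tendsto {q : ℝ} {w : ℕ → T → E} {u : T → E}
    (hw : ∀ t, Filter.Tendsto (fun n => w n t) Filter.atTop (nhds (u t))) {B : ℝ≥0∞}
    (hB : ∀ n, hVar q (w n) ≤ B) : hVar q u ≤ B := by
  refine hVar_le fun J t ht => ?_
  have h1 : Filter.Tendsto
      (fun n => (∑ j : Fin J, ‖w n (t j.succ) - w n (t j.castSucc)‖ₑ ^ q) ^ (1 / q)) Filter.atTop
      (nhds ((∑ j : Fin J, ‖u (t j.succ) - u (t j.castSucc)‖ₑ ^ q) ^ (1 / q))) := by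
    refine (ENNReal.continuous_rpow_const.tendsto _).comp (tendsto_finsetSum _ fun j _ => ?_)
    exact (ENNReal.continuous_rpow_const.tendsto _).comp
      ((continuous_enorm.tendsto _).comp ((hw _).sub (hw _)))
  exact le_of_tendsto' h1 fun n => (le_hVar q (w n) ht).trans (hB n)

theorem hVar_le_tsum {q : ℝ} (hq : 1 ≤ q) {w : ℕ → T → E} {u : T → E}
    (hw : ∀ t, Filter.Tendsto (fun n => w n t) Filter.atTop (nhds (u t)))
    (h0 : ∀ s t, w 0 s = w 0 t) :
    hVar q u ≤ ∑' n, hVar q (fun t => w (n + 1) t - w n t) := by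
  have hpart : ∀ n, hVar q (w n) ≤ ∑ i ∈ Finset.range n, hVar q (fun t => w (i + 1) t - w i t) := by
    intro n
    induction n with
    | zero => simp [hVar_eq_zero_of_const (zero_lt_one.trans_le hq) h0]
    | succ n ih =>
      rw [Finset.sum_range_succ]
      have := hVar_add_le hq (w n) (fun t => w (n + 1) t - w n t)
      simp only [add_sub_cancel] at this
      exact this.trans (add_le_add ih le_rfl)
  exact hVar_le_of_tendsto hw fun n =>
    (hpart n).trans (ENNReal.sum_le_tsum _)

/-- The `q`-variation of a function factoring through a monotone map into `{0, …, X - 1}`. -/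
theorem hVar_comp_monotone_le {q : ℝ} (hq : 1 ≤ q) {k : T → ℕ} (hk : Monotone k) {X : ℕ}
    (hX : ∀ t, k t < X) (h : ℕ → E) :
    hVar q (fun t => h (k t)) ≤ 2 * (∑ i ∈ Finset.range X, ‖h i‖ₑ ^ q) ^ (1 / q) := by
  classical
  have hq0 : 0 < q := zero_lt_one.trans_le hq
  set S := ∑ i ∈ Finset.range X, ‖h i‖ₑ ^ q with hS
  refine hVar_le fun J t ht => ?_
  have hkt : Monotone fun j => k (t j) := hk.comp ht.monotone
  set U : Finset (Fin J) := Finset.univ.filter fun j => k (t j.castSucc) < k (t j.succ) with hU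
  have hinj : ∀ (f : Fin J → ℕ), Set.InjOn f U → (∀ j, f j < X) →
      ∑ j ∈ U, ‖h (f j)‖ₑ ^ q ≤ S := by
    intro f hf hfX
    rw [← Finset.sum_image (f := fun i => ‖h i‖ₑ ^ q) hf]
    refine Finset.sum_le_sum_of_subset fun i hi => ?_
    obtain ⟨j, _, rfl⟩ := Finset.mem_image.1 hi
    exact Finset.mem_range.2 (hfX j)
  have hlt : ∀ i ∈ U, ∀ j, i < j →
      k (t i.castSucc) < k (t j.castSucc) := by
    intro i hi j hij
    exact (Finset.mem_filter.1 hi).2.trans_le (hkt (Fin.succ_le_castSucc_iff.2 hij))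
  have hlt' : ∀ i, ∀ j ∈ U, i < j → k (t i.succ) < k (t j.succ) := by
    intro i j hj hij
    exact (hkt (Fin.succ_le_castSucc_iff.2 hij)).trans_lt
      (Finset.mem_filter.1 hj).2
  have h1 : ∑ j ∈ U, ‖h (k (t j.castSucc))‖ₑ ^ q ≤ S := by
    refine hinj _ (fun i hi j hj hij => ?_) fun j => hX _
    rcases lt_trichotomy i j with hlt1 | heq | hlt1
    · exact absurd hij (hlt i hi j hlt1).ne
    · exact heq
    · exact absurd hij (hlt j hj i hlt1).ne'
  have h2 : ∑ j ∈ U, ‖h (k (t j.succ))‖ₑ ^ q ≤ S := by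
    refine hinj _ (fun i hi j hj hij => ?_) fun j => hX _
    rcases lt_trichotomy i j with hlt1 | heq | hlt1
    · exact absurd hij (hlt' i j hj hlt1).ne
    · exact heq
    · exact absurd hij (hlt' j i hi hlt1).ne'
  have h3 : ∑ j : Fin J, ‖h (k (t j.succ)) - h (k (t j.castSucc))‖ₑ ^ q
      = ∑ j ∈ U, ‖h (k (t j.succ)) - h (k (t j.castSucc))‖ₑ ^ q := by
    symm
    refine Finset.sum_subset (Finset.subset_univ _) fun j _ hj => ?_
    have : k (t j.succ) = k (t j.castSucc) := by
      have h4 : k (t j.castSucc) ≤ k (t j.succ) := hkt (Fin.castSucc_lt_succ).le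
      have h5 : ¬ k (t j.castSucc) < k (t j.succ) := by simpa [hU] using hj
      omega
    simp [this, hq0]
  rw [h3]
  calc (∑ j ∈ U, ‖h (k (t j.succ)) - h (k (t j.castSucc))‖ₑ ^ q) ^ (1 / q)
      ≤ (∑ j ∈ U, (‖h (k (t j.succ))‖ₑ + ‖h (k (t j.castSucc))‖ₑ) ^ q) ^ (1 / q) := by
        gcongr
        exact enorm_sub_le
    _ ≤ (∑ j ∈ U, ‖h (k (t j.succ))‖ₑ ^ q) ^ (1 / q)
        + (∑ j ∈ U, ‖h (k (t j.castSucc))‖ₑ ^ q) ^ (1 / q) := ENNReal.Lp_add_le _ _ _ hq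
    _ ≤ S ^ (1 / q) + S ^ (1 / q) := by gcongr
    _ = 2 * S ^ (1 / q) := (two_mul _).symm

theorem exists_monotone_control (c : T → E) {r A : ℝ} (hr : 0 < r)
    (h : hVar r c < ENNReal.ofReal A) :
    ∃ ψ : T → ℝ, (∀ t, 0 ≤ ψ t) ∧ (∀ t, ψ t < 1) ∧ Monotone ψ ∧
      ∀ s t, ‖c s - c t‖ ≤ A * |ψ s - ψ t| ^ (1 / r) := by
  have hA : 0 < A := ENNReal.ofReal_pos.1 (zero_le.trans_lt h)
  let S : T → Set ℝ≥0∞ := fun t => {x | ∃ (J : ℕ) (σ : Fin (J + 1) → T), StrictMono σ ∧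
    σ (Fin.last J) = t ∧ x = ∑ j : Fin J, ‖c (σ j.succ) - c (σ j.castSucc)‖ₑ ^ r}
  set Φ : T → ℝ≥0∞ := fun t => sSup (S t) with hΦ
  have hle : ∀ t, Φ t ≤ hVar r c ^ r := fun t => sSup_le <| by
    rintro x ⟨J, σ, hσ, -, rfl⟩
    exact sum_le_hVar_rpow hr c hσ
  have hlt : ∀ t, Φ t < ENNReal.ofReal (A ^ r) := fun t => by
    rw [← ENNReal.ofReal_rpow_of_pos hA]
    exact (hle t).trans_lt (ENNReal.rpow_lt_rpow h hr)
  have hfin : ∀ t, Φ t ≠ ⊤ := fun t => (hlt t).ne_top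
  have hsup : ∀ s t, s < t → Φ s + ‖c t - c s‖ₑ ^ r ≤ Φ t := by
    intro s t hst
    have hne : (S s).Nonempty :=
      ⟨0, 0, fun _ => s, fun i j hij => by omega, rfl, by simp⟩
    rw [hΦ]
    simp only
    rw [ENNReal.sSup_add hne]
    refine iSup₂_le ?_
    rintro x ⟨J, σ, hσ, rfl, rfl⟩
    refine le_sSup ⟨J + 1, Fin.snoc (α := fun _ => T) σ t, ?_, by simp, ?_⟩
    · rw [Fin.strictMono_iff_lt_succ]
      intro i
      refine Fin.lastCases ?_ (fun j => ?_) i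
      · simpa using hst
      · rw [← Fin.castSucc_succ, Fin.snoc_castSucc, Fin.snoc_castSucc]
        exact hσ Fin.castSucc_lt_succ
    · rw [Fin.sum_univ_castSucc]
      simp only [← Fin.castSucc_succ, Fin.snoc_castSucc, Fin.succ_last, Fin.snoc_last]
  have hmono : Monotone Φ := by
    intro s t hst
    rcases hst.eq_or_lt with rfl | hst
    · exact le_rfl
    · exact le_self_add.trans (hsup s t hst)
  have hAr : 0 < A ^ r := Real.rpow_pos_of_pos hA r
  have hmonoR : Monotone fun t => (Φ t).toReal / A ^ r := fun s t hst =>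
    div_le_div_of_nonneg_right (ENNReal.toReal_mono (hfin t) (hmono hst)) hAr.le
  have key : ∀ s t, s < t →
      ‖c s - c t‖ ≤ A * |(Φ s).toReal / A ^ r - (Φ t).toReal / A ^ r| ^ (1 / r) := by
    intro s t hst
    have h1 := ENNReal.toReal_mono (hfin t) (hsup s t hst)
    rw [ENNReal.toReal_add (hfin s) (by simp [hr.le]), ← ENNReal.toReal_rpow, toReal_enorm] at h1
    rw [abs_sub_comm, abs_of_nonneg (sub_nonneg.2 (hmonoR hst.le)), ← sub_div,
      Real.div_rpow (by linarith [Real.rpow_nonneg (norm_nonneg (c t - c s)) r]) hAr.le,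
      ← Real.rpow_mul hA.le, mul_one_div_cancel hr.ne', Real.rpow_one, mul_div_cancel₀ _ hA.ne',
      norm_sub_rev]
    calc ‖c t - c s‖ = (‖c t - c s‖ ^ r) ^ (1 / r) := by
          rw [← Real.rpow_mul (norm_nonneg _), mul_one_div_cancel hr.ne', Real.rpow_one]
      _ ≤ _ := by
          refine Real.rpow_le_rpow (by positivity) (by linarith) (by positivity)
  refine ⟨fun t => (Φ t).toReal / A ^ r, fun t => by positivity, fun t => ?_, hmonoR,
    fun s t => ?_⟩
  · rw [div_lt_one hAr]
    exact (ENNReal.lt_ofReal_iff_toReal_lt (hfin t)).1 (hlt t)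
  · rcases lt_trichotomy s t with hst | rfl | hst
    · exact key s t hst
    · simp only [sub_self, norm_zero]
      positivity
    · rw [norm_sub_rev, abs_sub_comm]
      exact key t s hst

/-- A multiscale decomposition of a family of bounded `r`-variation: approximants `w n` of `c` with
`O(D ^ n)` values, whose increments `v n` factor through monotone integer-valued maps `k n`. -/
theorem exists_multiscale [Nonempty T] (c : T → E) {r A : ℝ} (hr : 0 < r)
    (h : hVar r c < ENNReal.ofReal A) {D : ℕ} (hD : 1 < D) :
    ∃ (k : ℕ → T → ℕ) (w : ℕ → T → E) (v : ℕ → ℕ → E), (∀ n, Monotone (k n)) ∧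
      (∀ n t, k n t < D ^ (n + 1)) ∧ (∀ n t, w (n + 1) t - w n t = v n (k n t)) ∧
      (∀ s t, w 0 s = w 0 t) ∧ (∀ t, Filter.Tendsto (fun n => w n t) Filter.atTop (nhds (c t))) ∧
      ∀ n i, ‖v n i‖ ≤ A * (((D : ℝ) ^ n)⁻¹) ^ (1 / r) := by
  classical
  have hA : 0 < A := ENNReal.ofReal_pos.1 (zero_le.trans_lt h)
  obtain ⟨ψ, hψ0, hψ1, hψ, hc⟩ := exists_monotone_control c hr h
  have hD0 : (0 : ℝ) < D := by positivity
  set k : ℕ → T → ℕ := fun n t => ⌊(D : ℝ) ^ n * ψ t⌋₊ with hk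
  have hkmono : ∀ n, Monotone (k n) := fun n s t hst =>
    Nat.floor_mono (mul_le_mul_of_nonneg_left (hψ hst) (by positivity))
  have hklt : ∀ n t, k n t < D ^ n := fun n t => by
    rw [hk]
    simp only
    rw [Nat.floor_lt (mul_nonneg (by positivity) (hψ0 t))]
    push_cast
    exact mul_lt_of_lt_one_right (by positivity) (hψ1 t)
  have hkdiv : ∀ n t, k (n + 1) t / D = k n t := fun n t => by
    rw [hk]
    simp only
    rw [← Nat.floor_div_natCast]
    congr 1
    field_simp
    ring
  have hclose : ∀ n s t, k n s = k n t → ‖c s - c t‖ ≤ A * (((D : ℝ) ^ n)⁻¹) ^ (1 / r) := by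
    intro n s t hst
    refine (hc s t).trans ?_
    gcongr
    have h1 : |(D : ℝ) ^ n * ψ s - (D : ℝ) ^ n * ψ t| < 1 := by
      have e1 := Nat.floor_le (mul_nonneg (pow_nonneg hD0.le n) (hψ0 s))
      have e2 := Nat.floor_le (mul_nonneg (pow_nonneg hD0.le n) (hψ0 t))
      have e3 := Nat.lt_floor_add_one ((D : ℝ) ^ n * ψ s)
      have e4 := Nat.lt_floor_add_one ((D : ℝ) ^ n * ψ t)
      have e5 : (⌊(D : ℝ) ^ n * ψ s⌋₊ : ℝ) = ⌊(D : ℝ) ^ n * ψ t⌋₊ := congrArg _ hst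
      rw [abs_lt]
      constructor <;> linarith
    rw [← mul_sub, abs_mul, abs_of_pos (by positivity)] at h1
    rw [← one_div, le_div_iff₀' (by positivity)]
    exact h1.le
  choose rep hrep using fun (n : ℕ) (i : ℕ) =>
    show ∃ s : T, (∃ t, k n t = i) → k n s = i by
      by_cases hi : ∃ t, k n t = i
      · exact ⟨hi.choose, fun _ => hi.choose_spec⟩
      · exact ⟨Classical.arbitrary T, fun h => absurd h hi⟩
  have hrep' : ∀ n t, k n (rep n (k n t)) = k n t := fun n t => hrep n _ ⟨t, rfl⟩
  refine ⟨fun n => k (n + 1), fun n t => c (rep n (k n t)), fun n i =>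
    if ∃ t, k (n + 1) t = i then c (rep (n + 1) i) - c (rep n (i / D)) else 0,
    fun n => hkmono _, fun n => hklt _, fun n t => ?_, fun s t => ?_, fun t => ?_, fun n i => ?_⟩
  · dsimp only
    rw [if_pos ⟨t, rfl⟩, hkdiv]
  · have h0 : ∀ t, k 0 t = 0 := fun t => by simpa using hklt 0 t
    simp only [h0]
  · rw [tendsto_iff_norm_sub_tendsto_zero]
    refine squeeze_zero (fun _ => norm_nonneg _) (fun n => hclose n _ _ (hrep' n t)) ?_
    have h1 : Filter.Tendsto (fun n : ℕ => ((D : ℝ) ^ n)⁻¹) Filter.atTop (nhds 0) :=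
      (tendsto_pow_atTop_atTop_of_one_lt (by exact_mod_cast hD)).inv_tendsto_atTop
    have h2 := (h1.rpow_const (p := 1 / r) (Or.inr (by positivity))).const_mul A
    rwa [Real.zero_rpow (by positivity), mul_zero] at h2
  · dsimp only
    split_ifs with hi
    · obtain ⟨t, rfl⟩ := hi
      rw [hkdiv]
      refine hclose n _ _ ?_
      rw [hrep', ← hkdiv, hrep', hkdiv]
    · rw [norm_zero]
      positivity

end Variation

section Level

theorem sum_rpow_le_of_le {ι : Type*} (s : Finset ι) (f : ι → ℝ≥0∞) {q : ℝ} (hq : 2 ≤ q)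
    {m : ℝ≥0∞} (hm : ∀ i ∈ s, f i ≤ m) :
    ∑ i ∈ s, f i ^ q ≤ (∑ i ∈ s, f i ^ (2 : ℝ)) * m ^ (q - 2) := by
  rw [Finset.sum_mul]
  refine Finset.sum_le_sum fun i hi => ?_
  calc f i ^ q = f i ^ (2 : ℝ) * f i ^ (q - 2) := by
        rw [← ENNReal.rpow_add_of_nonneg _ _ (by norm_num) (by linarith)]
        congr 1
        ring
    _ ≤ _ := mul_le_mul_right (ENNReal.rpow_le_rpow (hm i hi) (by linarith)) _

theorem lq_le_l2 {ι : Type*} (s : Finset ι) (f : ι → ℝ≥0∞) {q : ℝ} (hq : 2 ≤ q) :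
    (∑ i ∈ s, f i ^ q) ^ (1 / q) ≤ (∑ i ∈ s, f i ^ (2 : ℝ)) ^ (1 / 2 : ℝ) := by
  set S := ∑ i ∈ s, f i ^ (2 : ℝ) with hS
  have hq0 : 0 < q := by linarith
  have h1 : ∀ i ∈ s, f i ≤ S ^ (1 / 2 : ℝ) := fun i hi => by
    have : f i ^ (2 : ℝ) ≤ S :=
      Finset.single_le_sum (f := fun i => f i ^ (2 : ℝ)) (fun _ _ => zero_le) hi
    calc f i = (f i ^ (2 : ℝ)) ^ (1 / 2 : ℝ) := by rw [← ENNReal.rpow_mul]; norm_num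
      _ ≤ _ := ENNReal.rpow_le_rpow this (by norm_num)
  calc (∑ i ∈ s, f i ^ q) ^ (1 / q) ≤ (S * (S ^ (1 / 2 : ℝ)) ^ (q - 2)) ^ (1 / q) :=
        ENNReal.rpow_le_rpow (sum_rpow_le_of_le s f hq h1) (by positivity)
    _ = (S ^ (q / 2)) ^ (1 / q) := by
        congr 1
        rw [← ENNReal.rpow_mul]
        nth_rewrite 1 [← ENNReal.rpow_one S]
        rw [← ENNReal.rpow_add_of_nonneg _ _ (by norm_num) (by linarith)]
        congr 1
        ring
    _ = _ := by
        rw [← ENNReal.rpow_mul]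
        congr 1
        field_simp

variable {Y : Type*} [MeasurableSpace Y] (μ : Measure Y)

/-- Two bounds for the `L²` norm of an `ℓ^q` sum of functions controlled in `L²` and in `L^∞`. -/
theorem lintegral_lq_sum_le {X : ℕ} (f : ℕ → Y → ℝ≥0∞) (hf : ∀ i, Measurable (f i)) {q : ℝ}
    (hq : 2 ≤ q) {K M δ : ℝ≥0∞} (hK : 1 ≤ K)
    (h2 : ∀ i, ∫⁻ y, f i y ^ (2 : ℝ) ∂μ ≤ K * μ Set.univ * δ ^ (2 : ℝ))
    (hM : ∀ i y, f i y ≤ M * δ) :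
    (∫⁻ y, ((∑ i ∈ Finset.range X, f i y ^ q) ^ (1 / q)) ^ (2 : ℝ) ∂μ) ^ (1 / 2 : ℝ)
      ≤ K * μ Set.univ ^ (1 / 2 : ℝ) *
        (min ((X : ℝ≥0∞) ^ (1 / 2 : ℝ)) ((X : ℝ≥0∞) ^ (1 / q) * M ^ (1 - 2 / q)) * δ) := by
  set P := μ Set.univ with hP
  have hq0 : 0 < q := by linarith
  have hqi : 1 / q ≤ 1 / 2 := one_div_le_one_div_of_le (by norm_num) hq
  set S : Y → ℝ≥0∞ := fun y => ∑ i ∈ Finset.range X, f i y ^ (2 : ℝ) with hS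
  have hSm : Measurable S := by fun_prop
  have hSint : ∫⁻ y, S y ∂μ ≤ X * (K * P * δ ^ (2 : ℝ)) := by
    rw [hS, lintegral_finsetSum _ fun i _ => by fun_prop]
    calc _ ≤ ∑ i ∈ Finset.range X, K * P * δ ^ (2 : ℝ) := Finset.sum_le_sum fun i _ => h2 i
      _ = _ := by simp
  have hKle : ∀ p : ℝ, 0 ≤ p → p ≤ 1 → K ^ p ≤ K := fun p _ hp1 => by
    simpa using ENNReal.rpow_le_rpow_of_exponent_le hK hp1
  have hA : (∫⁻ y, ((∑ i ∈ Finset.range X, f i y ^ q) ^ (1 / q)) ^ (2 : ℝ) ∂μ) ^ (1 / 2 : ℝ)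
      ≤ K * P ^ (1 / 2 : ℝ) * ((X : ℝ≥0∞) ^ (1 / 2 : ℝ) * δ) := by
    calc _ ≤ (∫⁻ y, S y ∂μ) ^ (1 / 2 : ℝ) := by
          gcongr with y
          calc _ ≤ (S y ^ (1 / 2 : ℝ)) ^ (2 : ℝ) := by
                gcongr
                exact lq_le_l2 _ _ hq
            _ = S y := by rw [← ENNReal.rpow_mul]; norm_num
      _ ≤ (X * (K * P * δ ^ (2 : ℝ))) ^ (1 / 2 : ℝ) := by gcongr
      _ = K ^ (1 / 2 : ℝ) * P ^ (1 / 2 : ℝ) * ((X : ℝ≥0∞) ^ (1 / 2 : ℝ) * δ) := by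
          rw [ENNReal.mul_rpow_of_nonneg _ _ (by norm_num),
            ENNReal.mul_rpow_of_nonneg _ _ (by norm_num),
            ENNReal.mul_rpow_of_nonneg _ _ (by norm_num), ← ENNReal.rpow_mul δ]
          norm_num
          ring
      _ ≤ _ := by
          gcongr
          exact hKle _ (by norm_num) (by norm_num)
  have hB : (∫⁻ y, ((∑ i ∈ Finset.range X, f i y ^ q) ^ (1 / q)) ^ (2 : ℝ) ∂μ) ^ (1 / 2 : ℝ)
      ≤ K * P ^ (1 / 2 : ℝ) * ((X : ℝ≥0∞) ^ (1 / q) * M ^ (1 - 2 / q) * δ) := by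
    have h2q : 2 / q ≤ 1 := (div_le_one hq0).2 hq
    have hpt : ∀ y, ((∑ i ∈ Finset.range X, f i y ^ q) ^ (1 / q)) ^ (2 : ℝ)
        ≤ S y ^ (2 / q) * (((M * δ) ^ (2 - 4 / q))) := fun y => by
      calc _ ≤ ((S y * (M * δ) ^ (q - 2)) ^ (1 / q)) ^ (2 : ℝ) := by
            gcongr
            exact sum_rpow_le_of_le _ _ hq fun i _ => hM i y
        _ = _ := by
            rw [← ENNReal.rpow_mul, ENNReal.mul_rpow_of_nonneg _ _ (by positivity),
              ← ENNReal.rpow_mul]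
            congr 2 <;> field_simp
            ring
    have hhol : ∫⁻ y, S y ^ (2 / q) ∂μ ≤ (∫⁻ y, S y ∂μ) ^ (2 / q) * P ^ (1 - 2 / q) := by
      have := lintegral_mul_norm_pow_le (μ := μ) (f := S) (g := fun _ => 1) hSm.aemeasurable
        aemeasurable_const (p := 2 / q) (q := 1 - 2 / q) (by positivity) (by linarith) (by ring)
      simpa using this
    calc _ ≤ (∫⁻ y, S y ^ (2 / q) * (M * δ) ^ (2 - 4 / q) ∂μ) ^ (1 / 2 : ℝ) := by
          gcongr with y
          exact hpt y
      _ = ((∫⁻ y, S y ^ (2 / q) ∂μ) * (M * δ) ^ (2 - 4 / q)) ^ (1 / 2 : ℝ) := by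
          rw [lintegral_mul_const _ (by fun_prop)]
      _ ≤ (((X * (K * P * δ ^ (2 : ℝ))) ^ (2 / q) * P ^ (1 - 2 / q)) *
            (M * δ) ^ (2 - 4 / q)) ^ (1 / 2 : ℝ) := by
          gcongr
          exact hhol.trans (by gcongr)
      _ = K ^ (1 / q) * (P ^ (1 / q) * P ^ (1 / 2 - 1 / q)) * ((X : ℝ≥0∞) ^ (1 / q) *
            M ^ (1 - 2 / q) * (δ ^ (2 / q) * δ ^ (1 - 2 / q))) := by
          have hh : (0 : ℝ) ≤ 1 / 2 := by norm_num
          have h4 : (0 : ℝ) ≤ 2 - 4 / q := by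
            have : 4 / q = 2 * (2 / q) := by ring
            linarith
          have h5 : (0 : ℝ) ≤ 2 / q := by positivity
          rw [ENNReal.mul_rpow_of_nonneg _ _ hh, ENNReal.mul_rpow_of_nonneg _ _ hh,
            ← ENNReal.rpow_mul, ← ENNReal.rpow_mul, ← ENNReal.rpow_mul]
          rw [show (2 - 4 / q) * (1 / 2) = 1 - 2 / q by ring,
            show 2 / q * (1 / 2) = 1 / q by ring,
            show (1 - 2 / q) * (1 / 2) = 1 / 2 - 1 / q by ring]
          have h6 : (0 : ℝ) ≤ 1 / q := by positivity
          rw [ENNReal.mul_rpow_of_nonneg _ _ h6, ENNReal.mul_rpow_of_nonneg _ _ h6,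
            ENNReal.mul_rpow_of_nonneg _ _ h6,
            ENNReal.mul_rpow_of_nonneg _ _ (by linarith : (0 : ℝ) ≤ 1 - 2 / q), ← ENNReal.rpow_mul,
            show 2 * (1 / q) = 2 / q by ring]
          ring
      _ = K ^ (1 / q) * P ^ (1 / 2 : ℝ) * ((X : ℝ≥0∞) ^ (1 / q) * M ^ (1 - 2 / q) * δ) := by
          rw [← ENNReal.rpow_add_of_nonneg _ _ (by positivity) (by linarith),
            ← ENNReal.rpow_add_of_nonneg _ _ (by positivity) (by linarith)]
          simp
      _ ≤ _ := by
          gcongr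
          exact hKle _ (by positivity) (by linarith)
  rcases min_choice ((X : ℝ≥0∞) ^ (1 / 2 : ℝ)) ((X : ℝ≥0∞) ^ (1 / q) * M ^ (1 - 2 / q)) with h | h
  · rw [h]; exact hA
  · rw [h]; exact hB

theorem lintegral_tsum_rpow_two_le (f : ℕ → Y → ℝ≥0∞) (hf : ∀ n, Measurable (f n)) :
    (∫⁻ y, (∑' n, f n y) ^ (2 : ℝ) ∂μ) ^ (1 / 2 : ℝ)
      ≤ ∑' n, (∫⁻ y, f n y ^ (2 : ℝ) ∂μ) ^ (1 / 2 : ℝ) := by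
  have hpart : ∀ N, (∫⁻ y, (∑ n ∈ Finset.range N, f n y) ^ (2 : ℝ) ∂μ) ^ (1 / 2 : ℝ)
      ≤ ∑ n ∈ Finset.range N, (∫⁻ y, f n y ^ (2 : ℝ) ∂μ) ^ (1 / 2 : ℝ) := by
    intro N
    induction N with
    | zero => simp
    | succ N ih =>
      simp_rw [Finset.sum_range_succ]
      refine le_trans ?_ (add_le_add ih le_rfl)
      exact ENNReal.lintegral_Lp_add_le (μ := μ) (p := 2)
        (f := fun y => ∑ n ∈ Finset.range N, f n y) (g := f N)
        (Finset.measurable_fun_sum _ fun n _ => hf n).aemeasurable (hf N).aemeasurable (by norm_num)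
  have hmono : ∀ y, Monotone fun N => (∑ n ∈ Finset.range N, f n y) ^ (2 : ℝ) := fun y a b hab =>
    ENNReal.rpow_le_rpow (Finset.sum_le_sum_of_subset (Finset.range_mono hab)) (by norm_num)
  have htend : Filter.Tendsto (fun N => ∫⁻ y, (∑ n ∈ Finset.range N, f n y) ^ (2 : ℝ) ∂μ)
      Filter.atTop (nhds (∫⁻ y, (∑' n, f n y) ^ (2 : ℝ) ∂μ)) :=
    lintegral_tendsto_of_tendsto_of_monotone (fun N => by fun_prop)
      (Filter.Eventually.of_forall hmono) (Filter.Eventually.of_forall fun y =>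
        (ENNReal.continuous_rpow_const.tendsto _).comp (ENNReal.tendsto_nat_tsum _))
  exact le_of_tendsto' ((ENNReal.continuous_rpow_const.tendsto _).comp htend) fun N =>
    (hpart N).trans (ENNReal.sum_le_tsum _)

end Level

section Summation

theorem tsum_le_of_two_sided_geometric (a : ℕ → ℝ≥0∞) (m : ℕ) {c p s : ℝ≥0∞}
    (h1 : ∀ n < m, a n ≤ c * p ^ (m - 1 - n)) (h2 : ∀ n, a (n + m) ≤ c * s ^ n) :
    ∑' n, a n ≤ c * ((1 - p)⁻¹ + (1 - s)⁻¹) := by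
  rw [← ENNReal.summable.sum_add_tsum_nat_add' (k := m), mul_add]
  refine add_le_add ?_ ?_
  · calc ∑ n ∈ Finset.range m, a n ≤ ∑ n ∈ Finset.range m, c * p ^ (m - 1 - n) :=
          Finset.sum_le_sum fun n hn => h1 n (Finset.mem_range.1 hn)
      _ = ∑ n ∈ Finset.range m, c * p ^ n := Finset.sum_range_reflect (fun n => c * p ^ n) m
      _ ≤ ∑' n, c * p ^ n := ENNReal.sum_le_tsum _
      _ = _ := by rw [ENNReal.tsum_mul_left, ENNReal.tsum_geometric]
  · calc ∑' n, a (n + m) ≤ ∑' n, c * s ^ n := ENNReal.tsum_le_tsum h2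
      _ = _ := by rw [ENNReal.tsum_mul_left, ENNReal.tsum_geometric]

theorem inv_one_sub_two_rpow_neg_le {x : ℝ} (hx : 0 < x) :
    (1 - ENNReal.ofReal ((2 : ℝ) ^ (-x)))⁻¹ ≤ ENNReal.ofReal (1 + 2 / x) := by
  have h1 : 1 + x / 2 ≤ (2 : ℝ) ^ x := by
    rw [Real.rpow_def_of_pos two_pos]
    have := Real.add_one_le_exp (Real.log 2 * x)
    nlinarith [Real.log_two_gt_d9]
  have h2 : (2 : ℝ) ^ (-x) ≤ (1 + x / 2)⁻¹ := by
    rw [Real.rpow_neg two_pos.le]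
    exact inv_anti₀ (by positivity) h1
  have h3 : (1 + 2 / x)⁻¹ = 1 - (1 + x / 2)⁻¹ := by field_simp; ring
  have h4 : 0 < (1 + 2 / x)⁻¹ := by positivity
  have h5 : (1 + 2 / x)⁻¹ ≤ 1 - (2 : ℝ) ^ (-x) := by linarith
  rw [← ENNReal.ofReal_one, ← ENNReal.ofReal_sub _ (by positivity),
    ← ENNReal.ofReal_inv_of_pos (h4.trans_le h5)]
  exact ENNReal.ofReal_le_ofReal (inv_le_of_inv_le₀ (by positivity) h5)

theorem natCast_rpow_eq_ofReal (m : ℕ) {s : ℝ} (hs : 0 ≤ s) :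
    (m : ℝ≥0∞) ^ s = ENNReal.ofReal ((m : ℝ) ^ s) := by
  rw [← ENNReal.ofReal_rpow_of_nonneg (Nat.cast_nonneg m) hs, ENNReal.ofReal_natCast]

theorem tsum_min_le {D N : ℕ} {r q A : ℝ} (h2r : 2 < r) (hrq : r < q) (hN : 1 ≤ N) (hA : 0 ≤ A)
    (hD1 : (2 : ℝ) ^ r ≤ D) (hD2 : (D : ℝ) ≤ 4 ^ r) :
    ∑' n : ℕ, min (((D ^ (n + 1) : ℕ) : ℝ≥0∞) ^ (1 / 2 : ℝ))
        (((D ^ (n + 1) : ℕ) : ℝ≥0∞) ^ (1 / q) * ((N : ℝ≥0∞) ^ (1 / 2 : ℝ)) ^ (1 - 2 / q)) *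
        ENNReal.ofReal (A * (((D : ℝ) ^ n)⁻¹) ^ (1 / r))
      ≤ 16 * ENNReal.ofReal A * ENNReal.ofReal (q / (q - r) + 2 / (r - 2)) *
        (N : ℝ≥0∞) ^ (1 / 2 - 1 / r) := by
  have hr0 : 0 < r := by linarith
  have hq0 : 0 < q := by linarith
  have hD0 : (0 : ℝ) < D := (Real.rpow_pos_of_pos two_pos r).trans_le hD1
  have hN0 : (1 : ℝ) ≤ N := by exact_mod_cast hN
  set β : ℝ := (D : ℝ) ^ (1 / r) with hβ
  set ν : ℝ := (N : ℝ) ^ (1 / r) with hν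
  have hβ2 : 2 ≤ β := by
    calc (2 : ℝ) = ((2 : ℝ) ^ r) ^ (1 / r) := by
          rw [← Real.rpow_mul two_pos.le, mul_one_div_cancel hr0.ne', Real.rpow_one]
      _ ≤ β := Real.rpow_le_rpow (by positivity) hD1 (by positivity)
  have hβ4 : β ≤ 4 := by
    calc β ≤ ((4 : ℝ) ^ r) ^ (1 / r) := Real.rpow_le_rpow (by positivity) hD2 (by positivity)
      _ = 4 := by
          rw [← Real.rpow_mul (by norm_num), mul_one_div_cancel hr0.ne', Real.rpow_one]
  have hβ0 : 0 < β := by linarith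
  have hν0 : 0 < ν := Real.rpow_pos_of_pos (by linarith) _
  have hNν : (N : ℝ) = ν ^ r := by
    rw [hν, ← Real.rpow_mul (by linarith), one_div_mul_cancel hr0.ne', Real.rpow_one]
  have hDβ : (D : ℝ) = β ^ r := by
    rw [hβ, ← Real.rpow_mul hD0.le, one_div_mul_cancel hr0.ne', Real.rpow_one]
  have hpow : ∀ n : ℕ, (D : ℝ) ^ n = (β ^ n) ^ r := fun n => by
    rw [hDβ, ← Real.rpow_natCast, ← Real.rpow_natCast, ← Real.rpow_mul hβ0.le,
      ← Real.rpow_mul hβ0.le, mul_comm]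
  set α := r / 2 - 1 with hα
  set γ := 1 - r / q with hγ
  have hα0 : 0 < α := by rw [hα]; linarith
  have hγ0 : 0 < γ := by rw [hγ, sub_pos, div_lt_one hq0]; exact hrq
  have hδ : ∀ n : ℕ, A * (((D : ℝ) ^ n)⁻¹) ^ (1 / r) = A * β * (β ^ (n + 1))⁻¹ := fun n => by
    rw [hpow, Real.inv_rpow (by positivity), ← Real.rpow_mul (by positivity),
      mul_one_div_cancel hr0.ne', Real.rpow_one, pow_succ]
    field_simp
  have hterm1 : ∀ n : ℕ, ((D ^ (n + 1) : ℕ) : ℝ≥0∞) ^ (1 / 2 : ℝ) *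
      ENNReal.ofReal (A * (((D : ℝ) ^ n)⁻¹) ^ (1 / r))
      = ENNReal.ofReal (A * β * ν ^ α * (β ^ (n + 1) / ν) ^ α) := fun n => by
    rw [natCast_rpow_eq_ofReal _ (by norm_num), ← ENNReal.ofReal_mul (by positivity), hδ,
      Nat.cast_pow, hpow]
    congr 1
    set x := β ^ (n + 1) with hx
    have hx0 : 0 < x := by positivity
    rw [← Real.rpow_mul hx0.le, Real.div_rpow hx0.le hν0.le, hα,
      show r * (1 / 2) = (r / 2 - 1) + 1 by ring, Real.rpow_add hx0, Real.rpow_one]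
    have : ν ^ (r / 2 - 1) ≠ 0 := (Real.rpow_pos_of_pos hν0 _).ne'
    field_simp
  have hterm2 : ∀ n : ℕ, ((D ^ (n + 1) : ℕ) : ℝ≥0∞) ^ (1 / q) *
      ((N : ℝ≥0∞) ^ (1 / 2 : ℝ)) ^ (1 - 2 / q) * ENNReal.ofReal (A * (((D : ℝ) ^ n)⁻¹) ^ (1 / r))
      = ENNReal.ofReal (A * β * ν ^ α * (β ^ (n + 1) / ν) ^ (-γ)) := fun n => by
    have h2q : 0 ≤ 1 - 2 / q := by rw [sub_nonneg, div_le_one hq0]; linarith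
    rw [← ENNReal.rpow_mul, natCast_rpow_eq_ofReal _ (by positivity),
      natCast_rpow_eq_ofReal _ (by positivity), ← ENNReal.ofReal_mul (by positivity),
      ← ENNReal.ofReal_mul (by positivity), hδ, Nat.cast_pow, hpow, hNν]
    congr 1
    set x := β ^ (n + 1) with hx
    have hx0 : 0 < x := by positivity
    rw [← Real.rpow_mul hx0.le, ← Real.rpow_mul hν0.le, Real.div_rpow hx0.le hν0.le,
      show r * (1 / q) = -γ + 1 by rw [hγ]; ring, Real.rpow_add hx0, Real.rpow_one,
      show r * (1 / 2 * (1 - 2 / q)) = α - -γ by rw [hγ, hα]; ring, Real.rpow_sub hν0]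
    field_simp
  have hex : ∃ n : ℕ, ν ≤ β ^ (n + 1) := by
    obtain ⟨n, hn⟩ := pow_unbounded_of_one_lt ν (by linarith : 1 < β)
    exact ⟨n, hn.le.trans (pow_le_pow_right₀ (by linarith) (Nat.le_succ n))⟩
  classical
  set m := Nat.find hex with hm
  have hmle : ν ≤ β ^ (m + 1) := Nat.find_spec hex
  set c := ENNReal.ofReal (A * β * ν ^ α) with hc
  have h1 : ∀ n < m, min (((D ^ (n + 1) : ℕ) : ℝ≥0∞) ^ (1 / 2 : ℝ))
        (((D ^ (n + 1) : ℕ) : ℝ≥0∞) ^ (1 / q) * ((N : ℝ≥0∞) ^ (1 / 2 : ℝ)) ^ (1 - 2 / q)) *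
        ENNReal.ofReal (A * (((D : ℝ) ^ n)⁻¹) ^ (1 / r))
        ≤ c * ENNReal.ofReal ((2 : ℝ) ^ (-α)) ^ (m - 1 - n) := by
    intro n hn
    refine (mul_le_mul_left (min_le_left _ _) _).trans ?_
    rw [hterm1, hc, ← ENNReal.ofReal_pow (by positivity), ← ENNReal.ofReal_mul (by positivity)]
    refine ENNReal.ofReal_le_ofReal (mul_le_mul_of_nonneg_left ?_ (by positivity))
    have hlt : β ^ (m - 1 + 1) < ν := not_le.1 (Nat.find_min hex (by omega : m - 1 < m))
    have hle : β ^ (n + 1) * 2 ^ (m - 1 - n) ≤ ν := by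
      calc β ^ (n + 1) * 2 ^ (m - 1 - n) ≤ β ^ (n + 1) * β ^ (m - 1 - n) := by gcongr
        _ = β ^ (m - 1 + 1) := by rw [← pow_add]; congr 1; omega
        _ ≤ ν := hlt.le
    calc (β ^ (n + 1) / ν) ^ α ≤ (((2 : ℝ) ^ (m - 1 - n))⁻¹) ^ α := by
          refine Real.rpow_le_rpow (by positivity) ?_ hα0.le
          rw [div_le_iff₀ hν0, inv_mul_eq_div, le_div_iff₀ (by positivity)]
          exact hle
      _ = ((2 : ℝ) ^ (-α)) ^ (m - 1 - n) := by
          rw [Real.inv_rpow (by positivity), ← Real.rpow_neg (by positivity),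
            ← Real.rpow_natCast, ← Real.rpow_natCast, ← Real.rpow_mul two_pos.le,
            ← Real.rpow_mul two_pos.le, mul_comm]
  have h2 : ∀ n, min (((D ^ (n + m + 1) : ℕ) : ℝ≥0∞) ^ (1 / 2 : ℝ))
        (((D ^ (n + m + 1) : ℕ) : ℝ≥0∞) ^ (1 / q) * ((N : ℝ≥0∞) ^ (1 / 2 : ℝ)) ^ (1 - 2 / q)) *
        ENNReal.ofReal (A * (((D : ℝ) ^ (n + m))⁻¹) ^ (1 / r))
        ≤ c * ENNReal.ofReal ((2 : ℝ) ^ (-γ)) ^ n := by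
    intro n
    refine (mul_le_mul_left (min_le_right _ _) _).trans ?_
    rw [hterm2, hc, ← ENNReal.ofReal_pow (by positivity), ← ENNReal.ofReal_mul (by positivity)]
    refine ENNReal.ofReal_le_ofReal (mul_le_mul_of_nonneg_left ?_ (by positivity))
    have hle : 2 ^ n * ν ≤ β ^ (n + m + 1) := by
      calc 2 ^ n * ν ≤ β ^ n * β ^ (m + 1) := by gcongr
        _ = β ^ (n + m + 1) := by rw [← pow_add]; congr 1
    calc (β ^ (n + m + 1) / ν) ^ (-γ) ≤ ((2 : ℝ) ^ n) ^ (-γ) := by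
          refine Real.rpow_le_rpow_of_nonpos (by positivity) ?_ (by linarith)
          rwa [le_div_iff₀ hν0]
      _ = ((2 : ℝ) ^ (-γ)) ^ n := by
          rw [← Real.rpow_natCast, ← Real.rpow_natCast, ← Real.rpow_mul two_pos.le,
            ← Real.rpow_mul two_pos.le, mul_comm]
  refine (tsum_le_of_two_sided_geometric _ m h1 h2).trans ?_
  have hqr : 0 < q - r := by linarith
  have hr2 : 0 < r - 2 := by linarith
  have hgeo : (1 - ENNReal.ofReal ((2 : ℝ) ^ (-α)))⁻¹ + (1 - ENNReal.ofReal ((2 : ℝ) ^ (-γ)))⁻¹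
      ≤ ENNReal.ofReal (4 * (q / (q - r) + 2 / (r - 2))) := by
    refine (add_le_add (inv_one_sub_two_rpow_neg_le hα0)
      (inv_one_sub_two_rpow_neg_le hγ0)).trans ?_
    rw [← ENNReal.ofReal_add (by positivity) (by positivity)]
    refine ENNReal.ofReal_le_ofReal ?_
    have e1 : 2 / α = 2 * (2 / (r - 2)) := by rw [hα]; field_simp
    have e2 : 2 / γ = 2 * (q / (q - r)) := by rw [hγ]; field_simp
    have e3 : 1 ≤ q / (q - r) := by rw [le_div_iff₀ hqr]; linarith
    have e4 : 0 < 2 / (r - 2) := by positivity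
    rw [e1, e2]
    linarith
  have hcle : c ≤ 4 * ENNReal.ofReal A * (N : ℝ≥0∞) ^ (1 / 2 - 1 / r) := by
    have e0 : 0 ≤ 1 / 2 - 1 / r := sub_nonneg.2 (one_div_le_one_div_of_le two_pos h2r.le)
    rw [natCast_rpow_eq_ofReal _ e0, hc, ENNReal.ofReal_mul (by positivity),
      ENNReal.ofReal_mul hA, mul_comm (ENNReal.ofReal A)]
    have e1 : ν ^ α = (N : ℝ) ^ (1 / 2 - 1 / r) := by
      rw [hν, ← Real.rpow_mul (by linarith)]
      congr 1
      rw [hα]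
      field_simp
    rw [e1]
    gcongr
    calc ENNReal.ofReal β ≤ ENNReal.ofReal 4 := ENNReal.ofReal_le_ofReal hβ4
      _ = 4 := by simp
  calc _ ≤ (4 * ENNReal.ofReal A * (N : ℝ≥0∞) ^ (1 / 2 - 1 / r)) *
        ENNReal.ofReal (4 * (q / (q - r) + 2 / (r - 2))) := mul_le_mul' hcle hgeo
    _ = (4 * 4) * ENNReal.ofReal A * ENNReal.ofReal (q / (q - r) + 2 / (r - 2)) *
        (N : ℝ≥0∞) ^ (1 / 2 - 1 / r) := by
        rw [ENNReal.ofReal_mul (by norm_num)]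
        simp only [ENNReal.ofReal_ofNat]
        ring
    _ = _ := by norm_num

end Summation

section ExpSum

variable {d : ℕ} {G : Finset (Fin d → ℤ)} (ξ : (Fin d → ℤ) → (Fin d → ℝ))

theorem norm_expSum_le (v : EuclideanSpace ℂ {l // l ∈ G}) (y : Fin d → ℝ) :
    ‖expSum ξ v y‖ ≤ (G.card : ℝ) ^ (1 / 2 : ℝ) * ‖v‖ := by
  have h1 : ‖expSum ξ v y‖ ≤ ∑ l, ‖v l‖ := by
    refine (norm_sum_le _ _).trans (Finset.sum_le_sum fun l _ => ?_)
    rw [norm_mul, norm_ce, mul_one]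
  refine h1.trans ?_
  have h2 := sq_sum_le_card_mul_sum_sq (s := Finset.univ) (f := fun l => ‖v l‖)
  rw [← EuclideanSpace.norm_sq_eq, Finset.card_univ, Fintype.card_coe] at h2
  rw [← Real.sqrt_eq_rpow]
  refine (sq_le_sq₀ (Finset.sum_nonneg fun _ _ => norm_nonneg _) (by positivity)).1 ?_
  rwa [mul_pow, Real.sq_sqrt (Nat.cast_nonneg _)]

theorem enorm_expSum_le (v : EuclideanSpace ℂ {l // l ∈ G}) (y : Fin d → ℝ) :
    ‖expSum ξ v y‖ₑ ≤ (G.card : ℝ≥0∞) ^ (1 / 2 : ℝ) * ‖v‖ₑ := by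
  rw [natCast_rpow_eq_ofReal _ (by norm_num), ← ofReal_norm, ← ofReal_norm,
    ← ENNReal.ofReal_mul (by positivity)]
  exact ENNReal.ofReal_le_ofReal (norm_expSum_le ξ v y)

theorem expSum_sub (u v : EuclideanSpace ℂ {l // l ∈ G}) (y : Fin d → ℝ) :
    expSum ξ (u - v) y = expSum ξ u y - expSum ξ v y := by
  simp only [expSum, PiLp.sub_apply, sub_mul, Finset.sum_sub_distrib]

theorem continuous_expSum_left (y : Fin d → ℝ) :
    Continuous fun v : EuclideanSpace ℂ {l // l ∈ G} => expSum ξ v y := by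
  unfold expSum
  fun_prop

theorem lintegral_hVar_expSum_le {a b : Fin d → ℝ} {K : ℝ≥0} (hK : 1 ≤ K) (hG : G.Nonempty)
    (hL2 : ∀ v : EuclideanSpace ℂ {l // l ∈ G},
      ∫⁻ y in Set.univ.pi (fun i => Set.Icc (a i) (b i)), ‖expSum ξ v y‖ₑ ^ (2 : ℝ)
        ≤ K * (∏ i, ENNReal.ofReal (b i - a i)) * ‖v‖ₑ ^ (2 : ℝ))
    {r q : ℝ} (h2r : 2 < r) (hrq : r < q) {T : Type*} [LinearOrder T]
    (c : T → EuclideanSpace ℂ {l // l ∈ G}) {A : ℝ} (hA : hVar r c < ENNReal.ofReal A) :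
    (∫⁻ y in Set.univ.pi (fun i => Set.Icc (a i) (b i)),
        hVar q (fun t => expSum ξ (c t) y) ^ (2 : ℝ)) ^ (1 / 2 : ℝ)
      ≤ (32 * K : ℝ≥0) * ENNReal.ofReal (q / (q - r) + 2 / (r - 2))
          * (∏ i, ENNReal.ofReal (b i - a i)) ^ (1 / 2 : ℝ)
          * (G.card : ℝ≥0∞) ^ ((1 / 2 - 1 / r) * (q / (q - 2)))
          * ENNReal.ofReal A := by
  have hq2 : 2 < q := h2r.trans hrq
  rcases isEmpty_or_nonempty T with hT | hT
  · have h0 : ∀ y, hVar q (fun t => expSum ξ (c t) y) = 0 := fun y =>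
      hVar_eq_zero_of_const (by linarith) fun s => hT.elim s
    simp [h0]
  have hA0 : 0 ≤ A := (ENNReal.ofReal_pos.1 (zero_le.trans_lt hA)).le
  set D : ℕ := ⌈(2 : ℝ) ^ r⌉₊ with hD
  have h4 : (4 : ℝ) ≤ 2 ^ r := by
    calc (4 : ℝ) = 2 ^ (2 : ℝ) := by norm_num
      _ ≤ 2 ^ r := Real.rpow_le_rpow_of_exponent_le (by norm_num) h2r.le
  have hD1 : (2 : ℝ) ^ r ≤ D := Nat.le_ceil _
  have hD2 : (D : ℝ) ≤ 4 ^ r := by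
    have h := Nat.ceil_lt_add_one (show (0 : ℝ) ≤ 2 ^ r by positivity)
    rw [show (4 : ℝ) = 2 * 2 by norm_num, Real.mul_rpow (by norm_num) (by norm_num)]
    nlinarith
  have hD3 : 1 < D := by
    have : (1 : ℝ) < D := by linarith
    exact_mod_cast this
  obtain ⟨k, w, v, hk, hkD, hwv, hw0, hwc, hv⟩ :=
    exists_multiscale c (by linarith : 0 < r) hA hD3
  set S := Set.univ.pi (fun i => Set.Icc (a i) (b i)) with hS
  set μ : Measure (Fin d → ℝ) := volume.restrict S with hμ
  have hμ1 : μ Set.univ = ∏ i, ENNReal.ofReal (b i - a i) := by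
    rw [hμ, Measure.restrict_apply_univ, hS, volume_pi_pi]
    simp [Real.volume_Icc]
  set δ : ℕ → ℝ≥0∞ := fun n => ENNReal.ofReal (A * (((D : ℝ) ^ n)⁻¹) ^ (1 / r)) with hδ
  have hvδ : ∀ n i, ‖v n i‖ₑ ≤ δ n := fun n i => by
    rw [← ofReal_norm]
    exact ENNReal.ofReal_le_ofReal (hv n i)
  have hmeas : ∀ n i, Measurable fun y => ‖expSum ξ (v n i) y‖ₑ := fun n i =>
    (continuous_expSum ξ _).measurable.enorm
  set F : ℕ → (Fin d → ℝ) → ℝ≥0∞ := fun n y =>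
    (∑ i ∈ Finset.range (D ^ (n + 1)), ‖expSum ξ (v n i) y‖ₑ ^ q) ^ (1 / q) with hF
  have hFm : ∀ n, Measurable (F n) := fun n =>
    (Finset.measurable_fun_sum _ fun i _ => (hmeas n i).pow_const _).pow_const _
  have hpt : ∀ y, hVar q (fun t => expSum ξ (c t) y) ≤ 2 * ∑' n, F n y := fun y => by
    rw [← ENNReal.tsum_mul_left]
    refine (hVar_le_tsum (by linarith) (w := fun n t => expSum ξ (w n t) y)
      (fun t => ((continuous_expSum_left ξ y).tendsto _).comp (hwc t))
      fun s t => by rw [hw0 s t]).trans (ENNReal.tsum_le_tsum fun n => ?_)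
    have h := hVar_comp_monotone_le (by linarith : 1 ≤ q) (hk n) (hkD n)
      fun i => expSum ξ (v n i) y
    simpa only [← expSum_sub, hwv] using h
  have hlev : ∀ n, (∫⁻ y, F n y ^ (2 : ℝ) ∂μ) ^ (1 / 2 : ℝ) ≤ K * μ Set.univ ^ (1 / 2 : ℝ)
      * (min (((D ^ (n + 1) : ℕ) : ℝ≥0∞) ^ (1 / 2 : ℝ)) (((D ^ (n + 1) : ℕ) : ℝ≥0∞) ^ (1 / q)
        * ((G.card : ℝ≥0∞) ^ (1 / 2 : ℝ)) ^ (1 - 2 / q)) * δ n) := fun n =>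
    lintegral_lq_sum_le μ (fun i y => ‖expSum ξ (v n i) y‖ₑ) (hmeas n) hq2.le
      (by exact_mod_cast hK)
      (fun i => by
        rw [hμ1]
        refine (hL2 (v n i)).trans ?_
        gcongr
        exact hvδ n i)
      fun i y => (enorm_expSum_le ξ _ y).trans (by gcongr; exact hvδ n i)
  have hN : 1 ≤ G.card := hG.card_pos
  have hexp : 1 / 2 - 1 / r ≤ (1 / 2 - 1 / r) * (q / (q - 2)) := by
    have h1 : 0 ≤ 1 / 2 - 1 / r := by
      have := one_div_le_one_div_of_le (by norm_num) h2r.le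
      linarith
    exact le_mul_of_one_le_right h1 ((one_le_div (by linarith)).2 (by linarith))
  calc (∫⁻ y, hVar q (fun t => expSum ξ (c t) y) ^ (2 : ℝ) ∂μ) ^ (1 / 2 : ℝ)
      ≤ (∫⁻ y, 2 ^ (2 : ℝ) * (∑' n, F n y) ^ (2 : ℝ) ∂μ) ^ (1 / 2 : ℝ) := by
        gcongr with y
        rw [← ENNReal.mul_rpow_of_nonneg _ _ (by norm_num)]
        gcongr
        exact hpt y
    _ = 2 * (∫⁻ y, (∑' n, F n y) ^ (2 : ℝ) ∂μ) ^ (1 / 2 : ℝ) := by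
        rw [lintegral_const_mul' _ _ (by simp), ENNReal.mul_rpow_of_nonneg _ _ (by norm_num),
          ← ENNReal.rpow_mul]
        norm_num
    _ ≤ 2 * ∑' n, (∫⁻ y, F n y ^ (2 : ℝ) ∂μ) ^ (1 / 2 : ℝ) := by
        gcongr
        exact lintegral_tsum_rpow_two_le μ F hFm
    _ ≤ 2 * (K * μ Set.univ ^ (1 / 2 : ℝ) * (16 * ENNReal.ofReal A
          * ENNReal.ofReal (q / (q - r) + 2 / (r - 2)) * (G.card : ℝ≥0∞) ^ (1 / 2 - 1 / r))) := by
        gcongr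
        refine (ENNReal.tsum_le_tsum hlev).trans ?_
        rw [ENNReal.tsum_mul_left]
        gcongr
        exact tsum_min_le h2r hrq hN hA0 hD1 hD2
    _ ≤ 2 * (K * μ Set.univ ^ (1 / 2 : ℝ) * (16 * ENNReal.ofReal A
          * ENNReal.ofReal (q / (q - r) + 2 / (r - 2))
          * (G.card : ℝ≥0∞) ^ ((1 / 2 - 1 / r) * (q / (q - 2))))) := by
        gcongr
        exact_mod_cast hN
    _ = _ := by
        rw [hμ1]
        push_cast
        ring

end ExpSum

/-- Variation of exponential sums with separated frequencies (cf. Nazarov–Oberlin–Thiele):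
for `2 < r < q`, the `L²(I)` norm of the `q`-variation of `t ↦ ∑_{l ∈ G} c_{t,l} e(ξ_l ⬝ y)`
is bounded by `C (q/(q-r) + 2/(r-2)) |I|^{1/2} N^{(1/2 - 1/r) q/(q-2)}` times the
`r`-variation of `(c_t)` in `ℓ²(G)`, where `N = |G|` and `C = C(c₀, d)`. -/
theorem variation_exp_sum (d : ℕ) (hd : 1 ≤ d) (c₀ : ℝ) (hc₀ : 0 < c₀) :
    ∃ C : ℝ≥0, ∀ (G : Finset (Fin d → ℤ)) (a b : Fin d → ℝ), (∀ i, a i < b i) →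
      ∀ ξ : (Fin d → ℤ) → (Fin d → ℝ),
      (∀ l ∈ G, ∀ l' ∈ G, ∀ i,
        c₀ * |(l i : ℝ) - (l' i : ℝ)| / (b i - a i) ≤ |ξ l i - ξ l' i|) →
      ∀ (r q : ℝ), 2 < r → r < q →
      ∀ (T : Type*) [LinearOrder T] (c : T → EuclideanSpace ℂ {l // l ∈ G}),
      (∫⁻ y in Set.univ.pi (fun i => Set.Icc (a i) (b i)),
          hVar q (fun t => ∑ l : {l // l ∈ G}, c t l * ce (∑ i, ξ (l : Fin d → ℤ) i * y i))
            ^ (2 : ℝ)) ^ (1 / 2 : ℝ)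
        ≤ C * ENNReal.ofReal (q / (q - r) + 2 / (r - 2))
            * (∏ i, ENNReal.ofReal (b i - a i)) ^ (1 / 2 : ℝ)
            * (G.card : ℝ≥0∞) ^ ((1 / 2 - 1 / r) * (q / (q - 2)))
            * hVar r c := by
  obtain ⟨K, hK, hL2⟩ := exists_lintegral_expSum_sq_le d c₀ hc₀
  refine ⟨32 * K, fun G a b hab ξ hξ r q h2r hrq T _ c => ?_⟩
  rcases G.eq_empty_or_nonempty with rfl | hG
  · have h0 : hVar q (fun _ : T => (0 : ℂ)) = 0 :=
      hVar_eq_zero_of_const (by linarith) fun _ _ => rfl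
    simp [h0]
  have hN : (G.card : ℝ≥0∞) ≠ 0 := by exact_mod_cast hG.card_pos.ne'
  have hS : 0 < q / (q - r) + 2 / (r - 2) := by
    have h1 : 0 < q - r := by linarith
    have h2 : 0 < r - 2 := by linarith
    have h3 : 0 < q := by linarith
    positivity
  have hP : ∏ i, ENNReal.ofReal (b i - a i) ≠ 0 :=
    Finset.prod_ne_zero_iff.2 fun i _ => (ENNReal.ofReal_pos.2 (sub_pos.2 (hab i))).ne'
  have hPt : ∏ i, ENNReal.ofReal (b i - a i) ≠ ⊤ :=
    ENNReal.prod_ne_top fun i _ => ENNReal.ofReal_ne_top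
  have hK0 : ((32 * K : ℝ≥0) : ℝ≥0∞) ≠ 0 :=
    ENNReal.coe_ne_zero.2 (mul_ne_zero (by norm_num) (zero_lt_one.trans_le hK).ne')
  set B : ℝ≥0∞ := ((32 * K : ℝ≥0) : ℝ≥0∞) * ENNReal.ofReal (q / (q - r) + 2 / (r - 2))
    * (∏ i, ENNReal.ofReal (b i - a i)) ^ (1 / 2 : ℝ)
    * (G.card : ℝ≥0∞) ^ ((1 / 2 - 1 / r) * (q / (q - 2))) with hB
  have hB0 : B ≠ 0 :=
    mul_ne_zero (mul_ne_zero (mul_ne_zero hK0 (ENNReal.ofReal_pos.2 hS).ne')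
      (ENNReal.rpow_pos (pos_iff_ne_zero.2 hP) hPt).ne')
      (ENNReal.rpow_pos (pos_iff_ne_zero.2 hN) (ENNReal.natCast_ne_top _)).ne'
  have hBt : B ≠ ⊤ :=
    ENNReal.mul_ne_top (ENNReal.mul_ne_top (ENNReal.mul_ne_top ENNReal.coe_ne_top
      ENNReal.ofReal_ne_top) (ENNReal.rpow_ne_top_of_nonneg (by norm_num) hPt))
      (ENNReal.rpow_ne_top_of_ne_zero hN (ENNReal.natCast_ne_top _))
  refine ENNReal.le_mul_of_forall_lt (Or.inl hB0) (Or.inl hBt) fun B' hB' A hA => ?_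
  rcases eq_or_ne A ⊤ with rfl | hAt
  · rw [ENNReal.mul_top (zero_le.trans_lt hB').ne']
    exact le_top
  rw [← ENNReal.ofReal_toReal hAt] at hA ⊢
  refine le_trans ?_ (mul_le_mul_left hB'.le _)
  exact lintegral_hVar_expSum_le ξ hK hG (hL2 G a b hab ξ hξ) h2r hrq c hA
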